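/- Fix λ > 0, δ > 0, an m×n real matrix A, vectors z ∈ R^m and x_0 ∈ [−1,1]^n, and set y = A x_0 + z and H(x) = λ‖x‖_1 + (1/2)‖y − A x‖_2^2. Let x̂ ∈ [−1,1]^n and x_δ ∈ [−1,1]^n satisfy ‖x̂ − x_δ‖_∞ ≤ δ. Then (1/n) |H(x̂) − H(x_δ)| ≤ λδ + σ_max(A) (δ/√n) ‖z‖_2 + 2 σ_max(A)^2 δ, where σ_max(A) is the largest singular value of A. -/

import Mathlib

open MeasureTheory Matrix

/-- The largest singular value (operator norm) of an `m × n` real matrix. -/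
noncomputable def sigmaMax {m n : ℕ} (A : Matrix (Fin m) (Fin n) ℝ) : ℝ :=
  ‖(Matrix.toEuclideanLin A).toContinuousLinearMap‖

/-- The LASSO cost `H(x) = λ ‖x‖₁ + (1/2) ‖y - A x‖₂²` where `y = A x₀ + z`. -/
noncomputable def lassoCost {m n : ℕ} (lam : ℝ) (A : Matrix (Fin m) (Fin n) ℝ)
    (z : Fin m → ℝ) (x₀ x : Fin n → ℝ) : ℝ :=
  lam * (∑ j, |x j|) +
    (1 / 2) * ∑ i, ((∑ j, A i j * x₀ j) + z i - ∑ j, A i j * x j) ^ 2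

/-- A vector whose entries are bounded by `c` has Euclidean norm at most `c √n`. -/
lemma EuclideanSpace.norm_le_mul_sqrt_card {n : ℕ} {c : ℝ} (hc : 0 ≤ c)
    (v : EuclideanSpace ℝ (Fin n)) (hv : ∀ i, |v i| ≤ c) : ‖v‖ ≤ c * √n := by
  rw [EuclideanSpace.norm_eq]
  refine Real.sqrt_le_iff.2 ⟨by positivity, ?_⟩
  calc ∑ i, ‖v i‖ ^ 2 ≤ ∑ _i : Fin n, c ^ 2 :=
        Finset.sum_le_sum fun i _ => pow_le_pow_left₀ (norm_nonneg _) (hv i) 2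
    _ = (c * √n) ^ 2 := by
        rw [mul_pow, Real.sq_sqrt (Nat.cast_nonneg n)]
        simp [mul_comm]

/-- Polarized difference of half squared norms, bounded by Cauchy–Schwarz. -/
lemma abs_half_sq_norm_sub_le {E : Type*} [NormedAddCommGroup E] [InnerProductSpace ℝ E]
    (u v : E) : |1 / 2 * ‖u‖ ^ 2 - 1 / 2 * ‖v‖ ^ 2| ≤ 1 / 2 * (‖u + v‖ * ‖u - v‖) := by
  have h : inner ℝ (u + v) (u - v) = ‖u‖ ^ 2 - ‖v‖ ^ 2 := by
    simp only [inner_add_left, inner_sub_right, real_inner_self_eq_norm_sq, real_inner_comm u v]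
    ring
  rw [← mul_sub, ← h, abs_mul, abs_of_pos (by norm_num : (0 : ℝ) < 1 / 2)]
  gcongr
  exact abs_real_inner_le_norm _ _

lemma norm_toEuclideanLin_le_sigmaMax {m n : ℕ} (A : Matrix (Fin m) (Fin n) ℝ)
    (v : EuclideanSpace ℝ (Fin n)) : ‖Matrix.toEuclideanLin A v‖ ≤ sigmaMax A * ‖v‖ :=
  (Matrix.toEuclideanLin A).toContinuousLinearMap.le_opNorm v

lemma sigmaMax_nonneg {m n : ℕ} (A : Matrix (Fin m) (Fin n) ℝ) : 0 ≤ sigmaMax A :=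
  norm_nonneg _

lemma lassoCost_eq_norm {m n : ℕ} (lam : ℝ) (A : Matrix (Fin m) (Fin n) ℝ)
    (z : Fin m → ℝ) (x₀ x : Fin n → ℝ) :
    lassoCost lam A z x₀ x = lam * (∑ j, |x j|) +
      1 / 2 * ‖WithLp.toLp 2 z + Matrix.toEuclideanLin A (WithLp.toLp 2 (x₀ - x))‖ ^ 2 := by
  rw [lassoCost, EuclideanSpace.real_norm_sq_eq]
  congr 3 with i
  simp only [PiLp.add_apply, Matrix.toLpLin_apply, Matrix.mulVec_sub,
    Pi.sub_apply, Matrix.mulVec, dotProduct]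
  ring

/-- **Stability of the LASSO cost under an `ℓ∞`-perturbation of the argument.**
If `x̂, x_δ ∈ [-1,1]^n` satisfy `‖x̂ - x_δ‖_∞ ≤ δ` then
`(1/n) |H(x̂) - H(x_δ)| ≤ λδ + σ_max(A) (δ/√n) ‖z‖₂ + 2 σ_max(A)² δ`. -/
theorem lasso_cost_perturbation {m n : ℕ} (lam δ : ℝ) (hlam : 0 < lam) (hδ : 0 < δ)
    (A : Matrix (Fin m) (Fin n) ℝ) (z : Fin m → ℝ) (x₀ xh xd : Fin n → ℝ)
    (hx₀ : ∀ i, x₀ i ∈ Set.Icc (-1 : ℝ) 1)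
    (hxh : ∀ i, xh i ∈ Set.Icc (-1 : ℝ) 1)
    (hxd : ∀ i, xd i ∈ Set.Icc (-1 : ℝ) 1)
    (hclose : ∀ i, |xh i - xd i| ≤ δ) :
    (n : ℝ)⁻¹ * |lassoCost lam A z x₀ xh - lassoCost lam A z x₀ xd| ≤
      lam * δ + sigmaMax A * (δ / Real.sqrt n) * Real.sqrt (∑ i, (z i) ^ 2) +
        2 * sigmaMax A ^ 2 * δ := by
  rcases n.eq_zero_or_pos with rfl | hn
  · have := sigmaMax_nonneg A
    simp only [Nat.cast_zero, _root_.inv_zero, zero_mul]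
    positivity
  set σ := sigmaMax A
  have hσ0 : 0 ≤ σ := sigmaMax_nonneg A
  set T := Matrix.toEuclideanLin A
  set ζ : EuclideanSpace ℝ (Fin m) := WithLp.toLp 2 z
  have hz : √(∑ i, z i ^ 2) = ‖ζ‖ := by simp [ζ, EuclideanSpace.norm_eq]
  have hT : ∀ (c : ℝ) (v : Fin n → ℝ), 0 ≤ c → (∀ i, |v i| ≤ c) →
      ‖T (WithLp.toLp 2 v)‖ ≤ σ * (c * √n) := fun c v hc hv =>
    (norm_toEuclideanLin_le_sigmaMax A _).trans <|
      mul_le_mul_of_nonneg_left (EuclideanSpace.norm_le_mul_sqrt_card hc _ hv) hσ0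
  have hbox : ∀ x : Fin n → ℝ, (∀ i, x i ∈ Set.Icc (-1 : ℝ) 1) →
      ‖T (WithLp.toLp 2 (x₀ - x))‖ ≤ σ * (2 * √n) := fun x hx =>
    hT 2 _ zero_le_two fun i => by
      obtain ⟨h₁, h₂⟩ := hx i
      obtain ⟨h₃, h₄⟩ := hx₀ i
      rw [Pi.sub_apply, abs_le]
      constructor <;> linarith
  set u := ζ + T (WithLp.toLp 2 (x₀ - xh)) with hu
  set v := ζ + T (WithLp.toLp 2 (x₀ - xd)) with hv
  have hsub : ‖u - v‖ ≤ σ * (δ * √n) := by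
    have : u - v = T (WithLp.toLp 2 (xd - xh)) := by
      rw [hu, hv, add_sub_add_left_eq_sub, ← map_sub, ← WithLp.toLp_sub, sub_sub_sub_cancel_left]
    rw [this]
    exact hT δ _ hδ.le fun i => by simpa only [Pi.sub_apply, abs_sub_comm] using hclose i
  have hadd : ‖u + v‖ ≤ 2 * ‖ζ‖ + σ * (4 * √n) := by
    have h₁ := norm_add_le u v
    have h₂ := norm_add_le ζ (T (WithLp.toLp 2 (x₀ - xh)))
    have h₃ := norm_add_le ζ (T (WithLp.toLp 2 (x₀ - xd)))
    linarith [hbox xh hxh, hbox xd hxd]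
  have hl1 : |(∑ j, |xh j|) - (∑ j, |xd j|)| ≤ n * δ := by
    rw [← Finset.sum_sub_distrib]
    refine (Finset.abs_sum_le_sum_abs _ _).trans ?_
    refine (Finset.sum_le_sum fun i _ => (abs_abs_sub_abs_le _ _).trans (hclose i)).trans ?_
    simp
  have hn' : (0 : ℝ) < n := by exact_mod_cast hn
  have hs : √(n : ℝ) ^ 2 = n := Real.sq_sqrt hn'.le
  have hs0 : 0 < √(n : ℝ) := Real.sqrt_pos.2 hn'
  rw [hz, inv_mul_le_iff₀ hn', lassoCost_eq_norm, lassoCost_eq_norm, add_sub_add_comm, ← mul_sub]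
  calc _ ≤ lam * (n * δ) + 1 / 2 * ((2 * ‖ζ‖ + σ * (4 * √n)) * (σ * (δ * √n))) := by
        refine (abs_add_le _ _).trans (add_le_add ?_ ?_)
        · rw [abs_mul, abs_of_pos hlam]
          gcongr
        · exact (abs_half_sq_norm_sub_le u v).trans (by gcongr)
    _ = _ := by
        generalize √(n : ℝ) = s at hs hs0 ⊢
        rw [← hs]
        field_simp
        ring
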